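/- Let c1,c2,c3 ∈ ℝ and define f(p) = mid(|c1|(1−p)², |c2|(1−p)², |c3|) for p ∈ [0,1]. Then the set {p ∈ (0,1) : f is not differentiable at p} has exactly two elements if and only if c3 ≠ 0, |c3| < |c1|, |c3| < |c2|, and |c1| ≠ |c2| (necessary and sufficient conditions for a double sudden change under the phase-flip channel). -/

import Mathlib

/-- The intermediate (median) value of three reals. -/
noncomputable def mid (a b c : ℝ) : ℝ := a + b + c - max a (max b c) - min a (min b c)

open Filter Topology

theorem mid_swap (a b c : ℝ) : mid a b c = mid b a c := by
  unfold mid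
  rw [max_left_comm, min_left_comm, add_comm a b]

theorem mid_eq_max_min {a b : ℝ} (h : a ≤ b) (c : ℝ) : mid a b c = max a (min b c) := by
  unfold mid
  grind

/-- A function touching two functions with distinct derivatives from above has a kink. -/
theorem not_differentiableAt_of_eventually_ge {f g : ℝ → ℝ} {p g' c : ℝ}
    (hg : HasDerivAt g g' p) (hg' : g' ≠ 0) (hgp : g p = f p) (hcp : c = f p)
    (hfg : ∀ᶠ x in 𝓝 p, g x ≤ f x) (hfc : ∀ᶠ x in 𝓝 p, c ≤ f x) :
    ¬ DifferentiableAt ℝ f p := by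
  intro hf
  have h₁ : IsLocalMin f p := by
    filter_upwards [hfc] with x hx
    rwa [← hcp]
  have h₂ : IsLocalMin (f - g) p := by
    filter_upwards [hfg] with x hx
    simp only [Pi.sub_apply]
    linarith
  have e₁ := h₁.hasDerivAt_eq_zero hf.hasDerivAt
  have e₂ := h₂.hasDerivAt_eq_zero (hf.hasDerivAt.sub hg)
  exact hg' (by linarith)

theorem not_differentiableAt_of_eventually_le {f g : ℝ → ℝ} {p g' c : ℝ}
    (hg : HasDerivAt g g' p) (hg' : g' ≠ 0) (hgp : g p = f p) (hcp : c = f p)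
    (hfg : ∀ᶠ x in 𝓝 p, f x ≤ g x) (hfc : ∀ᶠ x in 𝓝 p, f x ≤ c) :
    ¬ DifferentiableAt ℝ f p := by
  intro hf
  refine not_differentiableAt_of_eventually_ge (f := -f) (c := -c) hg.neg (neg_ne_zero.mpr hg')
    ?_ ?_ ?_ ?_ hf.neg
  · simp [hgp]
  · simp [hcp]
  · filter_upwards [hfg] with x hx
    simpa using hx
  · filter_upwards [hfc] with x hx
    simpa using hx

theorem hasDerivAt_mul_one_sub_sq (a p : ℝ) :
    HasDerivAt (fun x : ℝ => a * (1 - x) ^ 2) (-(2 * a * (1 - p))) p := by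
  have h := ((((hasDerivAt_id' p).const_sub 1).pow 2).const_mul a)
  refine h.congr_deriv ?_
  norm_num
  ring

theorem not_differentiableAt_clamp_iff {m M c p : ℝ} (hm : 0 ≤ m) (hmM : m ≤ M) (hc : 0 ≤ c)
    (hp : p < 1) :
    ¬ DifferentiableAt ℝ (fun x : ℝ => max (m * (1 - x) ^ 2) (min (M * (1 - x) ^ 2) c)) p ↔
      m < M ∧ 0 < c ∧ (m * (1 - p) ^ 2 = c ∨ M * (1 - p) ^ 2 = c) := by
  have hle : ∀ x : ℝ, m * (1 - x) ^ 2 ≤ M * (1 - x) ^ 2 := fun x => by gcongr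
  have hnn : ∀ x : ℝ, 0 ≤ m * (1 - x) ^ 2 := fun x => by positivity
  have hq : 0 < (1 - p) ^ 2 := by have := sub_pos.mpr hp; positivity
  have hcont : ∀ a : ℝ, ContinuousAt (fun x : ℝ => a * (1 - x) ^ 2) p := fun a =>
    (hasDerivAt_mul_one_sub_sq a p).continuousAt
  have hdiff : ∀ a : ℝ, DifferentiableAt ℝ (fun x : ℝ => a * (1 - x) ^ 2) p := fun a =>
    (hasDerivAt_mul_one_sub_sq a p).differentiableAt
  have hne : ∀ a : ℝ, 0 < c → a * (1 - p) ^ 2 = c → -(2 * a * (1 - p)) ≠ 0 := by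
    intro a h0 h
    have ha : a ≠ 0 := by rintro rfl; simp at h; exact h0.ne h
    have := (sub_pos.mpr hp).ne'
    simp [ha, this]
  constructor
  · intro h
    by_contra hcon
    apply h
    rcases hmM.eq_or_lt with rfl | hlt
    · simpa using hdiff m
    rcases hc.eq_or_lt with rfl | hc0
    · refine (hdiff m).congr_of_eventuallyEq (Eventually.of_forall fun x => ?_)
      have := hle x
      have := hnn x
      grind
    have hor : ¬ (m * (1 - p) ^ 2 = c ∨ M * (1 - p) ^ 2 = c) := fun h' => hcon ⟨hlt, hc0, h'⟩
    push Not at hor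
    rcases lt_or_gt_of_ne hor.1 with h1 | h1
    · rcases lt_or_gt_of_ne hor.2 with h2 | h2
      · refine (hdiff M).congr_of_eventuallyEq ?_
        filter_upwards [(hcont M).eventually_lt_const h2] with x hx
        have := hle x
        grind
      · refine (differentiableAt_const c).congr_of_eventuallyEq ?_
        filter_upwards [(hcont m).eventually_lt_const h1, (hcont M).eventually_const_lt h2]
          with x hx hx'
        grind
    · refine (hdiff m).congr_of_eventuallyEq ?_
      filter_upwards [(hcont m).eventually_const_lt h1] with x hx
      grind
  · rintro ⟨hlt, hc0, h | h⟩
    · have hM : c < M * (1 - p) ^ 2 := by rw [← h]; gcongr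
      refine not_differentiableAt_of_eventually_ge (c := c) (hasDerivAt_mul_one_sub_sq m p)
        (hne m hc0 h) (by grind) (by grind) (Eventually.of_forall fun x => le_max_left _ _) ?_
      filter_upwards [(hcont M).eventually_const_lt hM] with x hx
      grind
    · have hm' : m * (1 - p) ^ 2 < c := by rw [← h]; gcongr
      refine not_differentiableAt_of_eventually_le (c := c) (hasDerivAt_mul_one_sub_sq M p)
        (hne M hc0 h) (by grind) (by grind)
        (Eventually.of_forall fun x => max_le (hle x) (min_le_left _ _)) ?_
      filter_upwards [(hcont m).eventually_lt_const hm'] with x hx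
      grind

theorem mul_one_sub_sq_eq_iff {a c p : ℝ} (ha : 0 < a) (hp : p < 1) :
    a * (1 - p) ^ 2 = c ↔ p = 1 - √(c / a) := by
  have h1 : 0 < 1 - p := sub_pos.mpr hp
  constructor
  · rintro rfl
    rw [mul_div_cancel_left₀ _ ha.ne', Real.sqrt_sq h1.le]
    ring
  · intro h
    have hs : √(c / a) = 1 - p := by linarith
    have hpos : 0 < c / a := Real.sqrt_pos.mp (hs ▸ h1)
    rw [← hs, Real.sq_sqrt hpos.le]
    field_simp

theorem ncard_not_differentiableAt_clamp_eq_two_iff {m M c : ℝ} (hm : 0 ≤ m) (hmM : m ≤ M)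
    (hc : 0 ≤ c) :
    {p ∈ Set.Ioo (0 : ℝ) 1 | ¬ DifferentiableAt ℝ
      (fun x : ℝ => max (m * (1 - x) ^ 2) (min (M * (1 - x) ^ 2) c)) p}.ncard = 2 ↔
      0 < c ∧ c < m ∧ m < M := by
  constructor
  · intro h
    obtain ⟨x, y, hxy, hs⟩ := Set.ncard_eq_two.mp h
    have hx : x ∈ ({x, y} : Set ℝ) := by simp
    have hy : y ∈ ({x, y} : Set ℝ) := by simp
    rw [← hs] at hx hy
    obtain ⟨⟨hx0, hx1⟩, hx⟩ := hx
    obtain ⟨⟨hy0, hy1⟩, hy⟩ := hy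
    rw [not_differentiableAt_clamp_iff hm hmM hc hx1] at hx
    rw [not_differentiableAt_clamp_iff hm hmM hc hy1] at hy
    obtain ⟨hlt, hc0, hx⟩ := hx
    have key : ∀ z : ℝ, 0 < z → z < 1 → m * (1 - z) ^ 2 = c → c < m := by
      intro z hz0 hz1 hz
      have hm0 : 0 < m := hm.lt_of_ne (by rintro rfl; simp at hz; exact hc0.ne hz)
      rw [← hz]
      exact mul_lt_of_lt_one_right hm0 (by nlinarith)
    refine ⟨hc0, ?_, hlt⟩
    rcases hx with hx | hx
    · exact key x hx0 hx1 hx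
    rcases hy.2.2 with hy | hy
    · exact key y hy0 hy1 hy
    have hM0 : 0 < M := hm.trans_lt hlt
    rw [mul_one_sub_sq_eq_iff hM0 hx1] at hx
    rw [mul_one_sub_sq_eq_iff hM0 hy1] at hy
    exact absurd (hx.trans hy.symm) hxy
  · rintro ⟨hc0, hcm, hlt⟩
    have hm0 : 0 < m := hc0.trans hcm
    have hM0 : 0 < M := hm0.trans hlt
    have hmem : ∀ a : ℝ, 0 < a → c < a → 1 - √(c / a) ∈ Set.Ioo (0 : ℝ) 1 := by
      intro a ha hca
      have h1 : √(c / a) < 1 := by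
        rw [Real.sqrt_lt' one_pos, one_pow]
        exact (div_lt_one ha).mpr hca
      have h2 : 0 < √(c / a) := Real.sqrt_pos.mpr (div_pos hc0 ha)
      constructor <;> linarith
    refine Set.ncard_eq_two.mpr ⟨1 - √(c / m), 1 - √(c / M), ?_, ?_⟩
    · have : √(c / M) < √(c / m) := Real.sqrt_lt_sqrt (by positivity) (by gcongr)
      intro h
      linarith
    · ext p
      simp only [Set.mem_ofPred_eq, Set.mem_insert_iff, Set.mem_singleton_iff]
      constructor
      · rintro ⟨⟨-, hp1⟩, hp⟩
        rw [not_differentiableAt_clamp_iff hm hmM hc hp1, mul_one_sub_sq_eq_iff hm0 hp1,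
          mul_one_sub_sq_eq_iff hM0 hp1] at hp
        exact hp.2.2
      · intro h
        have hp : p ∈ Set.Ioo (0 : ℝ) 1 := by
          rcases h with rfl | rfl
          · exact hmem m hm0 hcm
          · exact hmem M hM0 (hcm.trans hlt)
        refine ⟨hp, ?_⟩
        rw [not_differentiableAt_clamp_iff hm hmM hc hp.2, mul_one_sub_sq_eq_iff hm0 hp.2,
          mul_one_sub_sq_eq_iff hM0 hp.2]
        exact ⟨hlt, hc0, h⟩

/-- Necessary and sufficient conditions for a double sudden change of the 1-norm geometric
discord under the phase-flip channel. -/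
theorem phaseFlip_doubleSuddenChange_iff (c₁ c₂ c₃ : ℝ) (f : ℝ → ℝ)
    (hf : ∀ p, f p = mid (|c₁| * (1 - p) ^ 2) (|c₂| * (1 - p) ^ 2) |c₃|) :
    {p ∈ Set.Ioo (0 : ℝ) 1 | ¬ DifferentiableAt ℝ f p}.ncard = 2 ↔
      c₃ ≠ 0 ∧ |c₃| < |c₁| ∧ |c₃| < |c₂| ∧ |c₁| ≠ |c₂| := by
  rw [← abs_pos (a := c₃)]
  rcases le_total |c₁| |c₂| with h | h
  · have hf' : f = fun x : ℝ => max (|c₁| * (1 - x) ^ 2) (min (|c₂| * (1 - x) ^ 2) |c₃|) := by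
      funext x
      rw [hf, mid_eq_max_min (by gcongr)]
    rw [hf', ncard_not_differentiableAt_clamp_eq_two_iff (abs_nonneg _) h (abs_nonneg _)]
    grind
  · have hf' : f = fun x : ℝ => max (|c₂| * (1 - x) ^ 2) (min (|c₁| * (1 - x) ^ 2) |c₃|) := by
      funext x
      rw [hf, mid_swap, mid_eq_max_min (by gcongr)]
    rw [hf', ncard_not_differentiableAt_clamp_eq_two_iff (abs_nonneg _) h (abs_nonneg _)]
    grind
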